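/- Let (X,d) be a geodesic metric space that is an Alexandrov space of nonnegative curvature, i.e., for all x,y,z ∈ X and every minimal geodesic γ:[0,1]→X from y to z, d(x,γ(1/2))² ≥ (1/2)d(x,y)² + (1/2)d(x,z)² − (1/4)d(y,z)². Then for any N ∈ ℕ, points x₁,…,x_N ∈ X, point y ∈ X, and weights a₁,…,a_N ∈ [0,1] with Σᵢ aᵢ = 1, one has Σ_{i,j} aᵢaⱼ( d(xᵢ,xⱼ)² − d(xᵢ,y)² − d(xⱼ,y)² ) ≤ 0. -/

import Mathlib

open Finset

/-- A unit-interval parametrized minimal (constant-speed, length-minimizing)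
geodesic from `y` to `z`. -/
def IsMinGeodesic {X : Type*} [MetricSpace X] (γ : ℝ → X) (y z : X) : Prop :=
  γ 0 = y ∧ γ 1 = z ∧
    ∀ s ∈ Set.Icc (0:ℝ) 1, ∀ t ∈ Set.Icc (0:ℝ) 1,
      dist (γ s) (γ t) = |s - t| * dist y z

/-- A continuous midpoint-concave function on `[0, 1]` that is nonnegative at the endpoints is
nonnegative. -/
theorem nonneg_of_midpoint_concave {g : ℝ → ℝ} (hc : ContinuousOn g (Set.Icc 0 1))
    (h0 : 0 ≤ g 0) (h1 : 0 ≤ g 1)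
    (hm : ∀ s ∈ Set.Icc (0 : ℝ) 1, ∀ t ∈ Set.Icc (0 : ℝ) 1, (g s + g t) / 2 ≤ g ((s + t) / 2))
    {t : ℝ} (ht : t ∈ Set.Icc (0 : ℝ) 1) : 0 ≤ g t := by
  refine le_of_forall_pos_le_add fun ε hε => ?_
  have hc' : ContinuousOn (fun t => g t + ε * (t * (1 - t))) (Set.Icc 0 1) :=
    hc.add (by fun_prop)
  obtain ⟨r, hr, hmin⟩ := isCompact_Icc.exists_isMinOn ⟨t, ht⟩ hc'
  have hmin' : ∀ s ∈ Set.Icc (0 : ℝ) 1, g r + ε * (r * (1 - r)) ≤ g s + ε * (s * (1 - s)) :=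
    fun s hs => hmin hs
  have hr0 : 0 ≤ g r + ε * (r * (1 - r)) := by
    rcases hr.1.eq_or_lt with h | hr_pos
    · subst h; simpa using h0
    rcases hr.2.eq_or_lt with h | hr_lt
    · subst h; simpa using h1
    exfalso
    obtain ⟨δ, hδ, hδr, hδr'⟩ : ∃ δ : ℝ, 0 < δ ∧ δ ≤ r ∧ δ ≤ 1 - r :=
      ⟨min r (1 - r), lt_min hr_pos (by linarith), min_le_left _ _, min_le_right _ _⟩
    have hs : r - δ ∈ Set.Icc (0 : ℝ) 1 := ⟨by linarith, by linarith⟩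
    have hs' : r + δ ∈ Set.Icc (0 : ℝ) 1 := ⟨by linarith, by linarith⟩
    have h2 := hm _ hs _ hs'
    rw [show (r - δ + (r + δ)) / 2 = r by ring] at h2
    have h3 := hmin' _ hs
    have h4 := hmin' _ hs'
    have h5 : 0 < ε * δ ^ 2 := by positivity
    nlinarith
  have h6 := hmin' t ht
  have h7 : t * (1 - t) ≤ 1 := by nlinarith [ht.1, ht.2]
  have h8 := mul_le_mul_of_nonneg_left h7 hε.le
  linarith

section NonnegativelyCurved

variable {X : Type*} [MetricSpace X]

theorem IsMinGeodesic.restrict {γ : ℝ → X} {y z : X} (hγ : IsMinGeodesic γ y z) {s t : ℝ}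
    (hs : s ∈ Set.Icc (0 : ℝ) 1) (ht : t ∈ Set.Icc (0 : ℝ) 1) :
    IsMinGeodesic (fun r => γ (s + (t - s) * r)) (γ s) (γ t) := by
  have hmem : ∀ r ∈ Set.Icc (0 : ℝ) 1, s + (t - s) * r ∈ Set.Icc (0 : ℝ) 1 := by
    intro r hr
    have h := (convex_Icc (0 : ℝ) 1) hs ht (sub_nonneg.2 hr.2) hr.1 (by ring)
    simp only [smul_eq_mul] at h
    convert h using 1
    ring
  refine ⟨by simp, by simp, fun u hu v hv => ?_⟩
  rw [hγ.2.2 _ (hmem u hu) _ (hmem v hv), hγ.2.2 s hs t ht,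
    show s + (t - s) * u - (s + (t - s) * v) = (u - v) * (t - s) by ring, abs_mul,
    abs_sub_comm t s, mul_assoc]

theorem IsMinGeodesic.continuousOn {γ : ℝ → X} {y z : X} (hγ : IsMinGeodesic γ y z) :
    ContinuousOn γ (Set.Icc 0 1) := by
  refine LipschitzOnWith.continuousOn (K := nndist y z)
    (LipschitzOnWith.of_dist_le_mul fun s hs t ht => ?_)
  rw [hγ.2.2 s hs t ht, Real.dist_eq, coe_nndist, mul_comm]

/-- Nonnegative curvature in the sense of Alexandrov: midpoint comparison along minimal
geodesics. -/
def MidpointComparison (X : Type*) [MetricSpace X] : Prop :=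
  ∀ (x y z : X) (γ : ℝ → X), IsMinGeodesic γ y z →
    dist x (γ (1/2)) ^ 2 ≥
      (1/2) * dist x y ^ 2 + (1/2) * dist x z ^ 2 - (1/4) * dist y z ^ 2

theorem MidpointComparison.le_dist_sq (halex : MidpointComparison X) (x : X) {y z : X}
    {γ : ℝ → X} (hγ : IsMinGeodesic γ y z) {t : ℝ} (ht : t ∈ Set.Icc (0 : ℝ) 1) :
    (1 - t) * dist x y ^ 2 + t * dist x z ^ 2 - t * (1 - t) * dist y z ^ 2 ≤
      dist x (γ t) ^ 2 := by
  have key := nonneg_of_midpoint_concave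
    (g := fun t => dist x (γ t) ^ 2 -
      ((1 - t) * dist x y ^ 2 + t * dist x z ^ 2 - t * (1 - t) * dist y z ^ 2))
    (((continuous_const.dist continuous_id).comp_continuousOn hγ.continuousOn |>.pow 2).sub
      (by fun_prop))
    (by simp [hγ.1]) (by simp [hγ.2.1]) ?_ ht
  · linarith
  intro r hr s hs
  have h := halex x _ _ _ (hγ.restrict hr hs)
  rw [hγ.2.2 r hr s hs, mul_pow, sq_abs,
    show r + (s - r) * (1 / 2) = (r + s) / 2 by ring] at h
  linear_combination h

/-- Twice the inner product, with respect to the base point `y`, of the Euclidean comparison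
vectors of `u` and `v`. -/
def comparisonForm (y u v : X) : ℝ :=
  dist u y ^ 2 + dist v y ^ 2 - dist u v ^ 2

theorem comparisonForm_comm (y u v : X) : comparisonForm y u v = comparisonForm y v u := by
  simp only [comparisonForm, dist_comm u v]
  ring

theorem comparisonForm_self (y u : X) : comparisonForm y u u = 2 * dist u y ^ 2 := by
  simp only [comparisonForm, dist_self]
  ring

theorem neg_two_mul_le_comparisonForm (y u v : X) :
    -(2 * (dist u y * dist v y)) ≤ comparisonForm y u v := by
  have h : dist u v ≤ dist u y + dist v y := dist_triangle_right u v y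
  have h2 := pow_le_pow_left₀ dist_nonneg h 2
  simp only [comparisonForm]
  linarith

/-- `h` moves every point halfway towards `y`, and this at most halves the comparison form. -/
structure IsHalving (y : X) (h : X → X) : Prop where
  dist_base : ∀ u, dist (h u) y = dist u y / 2
  dist_self : ∀ u, dist (h u) u = dist u y / 2
  form_le : ∀ u w, comparisonForm y (h u) w ≤ comparisonForm y u w / 2

theorem MidpointComparison.exists_isHalving (halex : MidpointComparison X)
    (hgeo : ∀ y z : X, ∃ γ : ℝ → X, IsMinGeodesic γ y z) (y : X) :
    ∃ h : X → X, IsHalving y h := by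
  choose γ hγ using hgeo y
  have h0 : (0 : ℝ) ∈ Set.Icc (0 : ℝ) 1 := by norm_num
  have h1 : (1 : ℝ) ∈ Set.Icc (0 : ℝ) 1 := by norm_num
  have h2 : (1 / 2 : ℝ) ∈ Set.Icc (0 : ℝ) 1 := by norm_num
  have hb : ∀ u, dist (γ u (1 / 2)) y = dist u y / 2 := by
    intro u
    have h := (hγ u).2.2 _ h2 _ h0
    rw [(hγ u).1, sub_zero, abs_of_pos one_half_pos, dist_comm y u] at h
    linarith
  refine ⟨fun u => γ u (1 / 2), hb, fun u => ?_, fun u w => ?_⟩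
  · have h := (hγ u).2.2 _ h2 _ h1
    rw [(hγ u).2.1, abs_sub_comm, show (1 : ℝ) - 1 / 2 = 1 / 2 by norm_num,
      abs_of_pos one_half_pos, dist_comm y u] at h
    linarith
  · have h := halex w _ _ _ (hγ u)
    simp only [comparisonForm, hb]
    rw [dist_comm w u, dist_comm y u, dist_comm w (γ u (1 / 2))] at h
    linarith

theorem IsHalving.form_le_right {y : X} {h : X → X} (hh : IsHalving y h) (u w : X) :
    comparisonForm y u (h w) ≤ comparisonForm y u w / 2 := by
  rw [comparisonForm_comm y u, comparisonForm_comm y u]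
  exact hh.form_le w u

theorem IsHalving.form_le_both {y : X} {h : X → X} (hh : IsHalving y h) (u w : X) :
    comparisonForm y (h u) (h w) ≤ comparisonForm y u w / 4 := by
  linarith [hh.form_le u (h w), hh.form_le_right u w]

theorem IsHalving.antitone_form {y : X} {h : X → X} (hh : IsHalving y h) (u w : X) :
    Antitone fun k : ℕ => 4 ^ k * comparisonForm y (h^[k] u) (h^[k] w) := by
  refine antitone_nat_of_succ_le fun k => ?_
  simp only [Function.iterate_succ_apply']
  have h4 := mul_le_mul_of_nonneg_left (hh.form_le_both (h^[k] u) (h^[k] w))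
    (by positivity : (0 : ℝ) ≤ 4 ^ (k + 1))
  rw [pow_succ] at h4 ⊢
  linarith

theorem IsHalving.dist_iterate {y : X} {h : X → X} (hh : IsHalving y h) (u : X) (k : ℕ) :
    2 ^ k * dist (h^[k] u) y = dist u y := by
  induction k with
  | zero => simp
  | succ k ih =>
    rw [Function.iterate_succ_apply', hh.dist_base, ← ih]
    ring

theorem IsHalving.exists_form_sub_le {y : X} {h : X → X} (hh : IsHalving y h) (u w : X)
    {ε : ℝ} (hε : 0 < ε) :
    ∃ k : ℕ, 4 ^ k * comparisonForm y (h^[k] u) (h^[k] w) -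
      4 ^ (k + 1) * comparisonForm y (h^[k + 1] u) (h^[k + 1] w) ≤ ε := by
  have hbdd : BddBelow (Set.range fun k : ℕ =>
      (4 : ℝ) ^ k * comparisonForm y (h^[k] u) (h^[k] w)) := by
    refine ⟨-(2 * (dist u y * dist w y)), ?_⟩
    rintro _ ⟨k, rfl⟩
    have h1 := mul_le_mul_of_nonneg_left
      (neg_two_mul_le_comparisonForm y (h^[k] u) (h^[k] w)) (by positivity : (0 : ℝ) ≤ 4 ^ k)
    refine le_trans (le_of_eq ?_) h1
    rw [← hh.dist_iterate u k, ← hh.dist_iterate w k,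
      show (4 : ℝ) ^ k = 2 ^ k * 2 ^ k by rw [← mul_pow]; norm_num]
    ring
  have hlim := tendsto_atTop_ciInf (hh.antitone_form u w) hbdd
  have hdiff := hlim.sub (hlim.comp (Filter.tendsto_add_atTop_nat 1))
  rw [sub_self] at hdiff
  obtain ⟨k, hk⟩ := (hdiff.eventually (gt_mem_nhds hε)).exists
  exact ⟨k, hk.le⟩

/-- If the comparison form of `u, w` is almost homogeneous, then the point `m` dividing a geodesic
between the halved points is almost the corresponding combination of comparison vectors. -/
theorem MidpointComparison.dist_sq_le (halex : MidpointComparison X) {y : X} {h : X → X}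
    (hh : IsHalving y h) {u w : X} {η : ℝ}
    (hη : comparisonForm y u w ≤ 4 * comparisonForm y (h u) (h w) + η)
    {γ : ℝ → X} (hγ : IsMinGeodesic γ (h u) (h w)) {t : ℝ} (ht : t ∈ Set.Icc (0 : ℝ) 1)
    (hη0 : 0 ≤ η) :
    dist (γ t) y ^ 2 ≤ (1 - t) ^ 2 * dist (h u) y ^ 2 + t ^ 2 * dist (h w) y ^ 2 +
      t * (1 - t) * comparisonForm y (h u) (h w) + η := by
  have h1 := halex.le_dist_sq u hγ ht
  have h2 := hh.form_le_right u w
  have h3 := hh.form_le u (γ t)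
  have h4 : dist (h u) (γ t) = t * dist (h u) (h w) := by
    have := hγ.2.2 0 (by norm_num) t ht
    rwa [hγ.1, zero_sub, abs_neg, abs_of_nonneg ht.1] at this
  have h5 : dist u (h w) ^ 2 ≥
      4 * dist (h u) y ^ 2 + dist (h w) y ^ 2 -
        2 * comparisonForm y (h u) (h w) - η / 2 := by
    have e : comparisonForm y u (h w) =
      dist u y ^ 2 + dist (h w) y ^ 2 - dist u (h w) ^ 2 := rfl
    have e' := hh.dist_base u
    rw [show dist u y = 2 * dist (h u) y by linarith] at e
    linarith
  have h6 := mul_le_mul_of_nonneg_left h5 ht.1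
  have h7 : t * η ≤ η := mul_le_of_le_one_left hη0 ht.2
  have h8 : dist u (h u) = dist (h u) y := by rw [dist_comm, hh.dist_self, hh.dist_base]
  have h9 : dist u y = 2 * dist (h u) y := by rw [hh.dist_base]; ring
  rw [h8] at h1
  have h10 := mul_nonneg ht.1 hη0
  simp only [comparisonForm, h4, h9] at h3 h6 ⊢
  nlinarith

theorem MidpointComparison.form_geodesic_le (halex : MidpointComparison X) {y p q : X}
    {γ : ℝ → X} (hγ : IsMinGeodesic γ p q) {t : ℝ} (ht : t ∈ Set.Icc (0 : ℝ) 1) {η : ℝ}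
    (hη : dist (γ t) y ^ 2 ≤ (1 - t) ^ 2 * dist p y ^ 2 + t ^ 2 * dist q y ^ 2 +
      t * (1 - t) * comparisonForm y p q + η) (v : X) :
    comparisonForm y (γ t) v ≤
      (1 - t) * comparisonForm y p v + t * comparisonForm y q v + η := by
  have h1 := halex.le_dist_sq v hγ ht
  simp only [comparisonForm, dist_comm v] at *
  linarith

theorem MidpointComparison.sum_comparisonForm_nonneg (halex : MidpointComparison X)
    (hgeo : ∀ y z : X, ∃ γ : ℝ → X, IsMinGeodesic γ y z) (y : X) (N : ℕ) :
    ∀ (x : Fin N → X) (a : Fin N → ℝ), (∀ i, 0 ≤ a i) →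
      0 ≤ ∑ i, ∑ j, a i * a j * comparisonForm y (x i) (x j) := by
  induction N with
  | zero => simp
  | succ N ih =>
  cases N with
  | zero =>
    intro x a _
    simp only [Fin.sum_univ_one, Nat.reduceAdd, Fin.isValue, comparisonForm_self]
    exact mul_nonneg (mul_self_nonneg _) (by positivity)
  | succ n =>
  intro x a ha
  obtain ⟨h, hh⟩ := halex.exists_isHalving hgeo y
  have sum_split : ∀ (m : ℕ) (x : Fin (m + 1) → X) (a : Fin (m + 1) → ℝ),
      ∑ i, ∑ j, a i * a j * comparisonForm y (x i) (x j) =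
        a 0 ^ 2 * comparisonForm y (x 0) (x 0) +
          2 * a 0 * ∑ j : Fin m, a j.succ * comparisonForm y (x 0) (x j.succ) +
          ∑ i : Fin m, ∑ j : Fin m,
            a i.succ * a j.succ * comparisonForm y (x i.succ) (x j.succ) := by
    intro m x a
    simp only [Fin.sum_univ_succ, Finset.sum_add_distrib, Finset.mul_sum]
    have e : ∀ i : Fin m, a i.succ * a 0 * comparisonForm y (x i.succ) (x 0) =
        a 0 * a i.succ * comparisonForm y (x 0) (x i.succ) := fun i => by
      rw [comparisonForm_comm]; ring
    have e' : ∀ i : Fin m, 2 * a 0 * (a i.succ * comparisonForm y (x 0) (x i.succ)) =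
        a 0 * a i.succ * comparisonForm y (x 0) (x i.succ) +
          a 0 * a i.succ * comparisonForm y (x 0) (x i.succ) := fun i => by ring
    simp only [e, e', Finset.sum_add_distrib]
    ring
  set A := a 0 + a 1 with hA
  have hA0 : 0 ≤ A := add_nonneg (ha 0) (ha 1)
  obtain ⟨t, ht, ht0, ht1⟩ : ∃ t ∈ Set.Icc (0 : ℝ) 1, a 0 = A * (1 - t) ∧ a 1 = A * t := by
    rcases hA0.eq_or_lt with h0 | hpos
    · refine ⟨0, by norm_num, ?_, ?_⟩ <;> linarith [ha 0, ha 1]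
    · refine ⟨a 1 / A, ⟨div_nonneg (ha 1) hA0, (div_le_one hpos).2 (by linarith [ha 0])⟩, ?_, ?_⟩
      · field_simp; linarith
      · field_simp
  set S := ∑ j : Fin n, a j.succ.succ with hS
  have hS0 : 0 ≤ S := Finset.sum_nonneg fun j _ => ha _
  set T := ∑ i, ∑ j, a i * a j * comparisonForm y (x i) (x j) with hT
  have key : ∀ ε > 0, -(4 * (2 * A ^ 2 + 2 * A * S) * ε) ≤ T := by
    intro ε hε
    obtain ⟨k, hk⟩ := hh.exists_form_sub_le (x 0) (x 1) hε
    set z : Fin (n + 2) → X := fun i => h^[k + 1] (x i) with hz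
    obtain ⟨γ, hγ⟩ := hgeo (z 0) (z 1)
    set η := ε / 4 ^ k with hη
    have h4k : (0 : ℝ) < 4 ^ k := by positivity
    have hη0 : 0 ≤ η := by positivity
    have hεη : 4 ^ k * η = ε := by rw [hη]; field_simp
    have hhom : comparisonForm y (h^[k] (x 0)) (h^[k] (x 1)) ≤
        4 * comparisonForm y (h (h^[k] (x 0))) (h (h^[k] (x 1))) + η := by
      simp only [Function.iterate_succ_apply'] at hk
      refine le_of_mul_le_mul_left ?_ h4k
      rw [mul_add, hεη]
      rw [pow_succ] at hk
      linarith
    have hz0 : ∀ i, z i = h (h^[k] (x i)) := fun i => Function.iterate_succ_apply' _ _ _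
    have hm : dist (γ t) y ^ 2 ≤ (1 - t) ^ 2 * dist (z 0) y ^ 2 + t ^ 2 * dist (z 1) y ^ 2 +
        t * (1 - t) * comparisonForm y (z 0) (z 1) + η := by
      rw [hz0, hz0] at hγ ⊢
      exact halex.dist_sq_le hh hhom hγ ht hη0
    have hscale : 4 ^ (k + 1) * ∑ i, ∑ j, a i * a j * comparisonForm y (z i) (z j) ≤ T := by
      simp only [hT, Finset.mul_sum]
      refine Finset.sum_le_sum fun i _ => Finset.sum_le_sum fun j _ => ?_
      have h1 := hh.antitone_form (x i) (x j) (Nat.zero_le (k + 1))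
      have h2 := mul_le_mul_of_nonneg_left h1 (mul_nonneg (ha i) (ha j))
      simp only [pow_zero, one_mul, Function.iterate_zero, id] at h2
      linarith
    have hmerge := ih (Fin.cons (γ t) fun j : Fin n => z j.succ.succ)
      (Fin.cons A fun j : Fin n => a j.succ.succ)
      (Fin.cases (by simpa using hA0) fun j => by simpa using ha _)
    rw [sum_split] at hmerge
    simp only [Fin.cons_zero, Fin.cons_succ] at hmerge
    have hsum : ∑ j : Fin n, a j.succ.succ * comparisonForm y (γ t) (z j.succ.succ) ≤
        (1 - t) * ∑ j : Fin n, a j.succ.succ * comparisonForm y (z 0) (z j.succ.succ) +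
          t * ∑ j : Fin n, a j.succ.succ * comparisonForm y (z 1) (z j.succ.succ) +
          S * η := by
      simp only [hS, Finset.mul_sum, Finset.sum_mul, ← Finset.sum_add_distrib]
      refine Finset.sum_le_sum fun j _ => ?_
      have h1 := mul_le_mul_of_nonneg_left
        (halex.form_geodesic_le hγ ht hm (z j.succ.succ)) (ha j.succ.succ)
      linarith
    have hsum' := mul_le_mul_of_nonneg_left hsum (mul_nonneg zero_le_two hA0)
    have hm' := mul_le_mul_of_nonneg_left hm (mul_nonneg zero_le_two (sq_nonneg A))
    have hz_sum : -((2 * A ^ 2 + 2 * A * S) * η) ≤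
        ∑ i, ∑ j, a i * a j * comparisonForm y (z i) (z j) := by
      rw [sum_split, sum_split, Fin.sum_univ_succ]
      simp only [Fin.succ_zero_eq_one, comparisonForm_self] at hmerge ⊢
      rw [ht0, ht1]
      linarith
    have h1 := mul_le_mul_of_nonneg_left hz_sum (by positivity : (0 : ℝ) ≤ 4 ^ (k + 1))
    refine le_trans (le_of_eq ?_) (h1.trans hscale)
    rw [← hεη, pow_succ]
    ring
  by_contra! hneg
  set C := 4 * (2 * A ^ 2 + 2 * A * S) with hC
  have hC0 : 0 ≤ C := by positivity
  have h1 := key (-T / (C + 1)) (div_pos (by linarith) (by linarith))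
  have h2 : C * (-T / (C + 1)) < -T := by
    rw [← mul_div_assoc, div_lt_iff₀ (by linarith)]
    linarith
  linarith

end NonnegativelyCurved

/-- Sturm's inequality holds in any geodesic space of nonnegative Alexandrov curvature. -/
theorem stmt0 {X : Type*} [MetricSpace X]
    (hgeo : ∀ y z : X, ∃ γ : ℝ → X, IsMinGeodesic γ y z)
    (halex : ∀ (x y z : X) (γ : ℝ → X), IsMinGeodesic γ y z →
      dist x (γ (1/2)) ^ 2 ≥
        (1/2) * dist x y ^ 2 + (1/2) * dist x z ^ 2 - (1/4) * dist y z ^ 2)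
    (N : ℕ) (x : Fin N → X) (y : X) (a : Fin N → ℝ)
    (ha0 : ∀ i, 0 ≤ a i) (ha1 : ∀ i, a i ≤ 1) (hsum : ∑ i, a i = 1) :
    ∑ i, ∑ j, a i * a j *
      (dist (x i) (x j) ^ 2 - dist (x i) y ^ 2 - dist (x j) y ^ 2) ≤ 0 := by
  have h := MidpointComparison.sum_comparisonForm_nonneg halex hgeo y N x a ha0
  rw [← neg_nonneg]
  refine h.trans_eq ?_
  simp only [← Finset.sum_neg_distrib, comparisonForm]
  refine Finset.sum_congr rfl fun i _ => Finset.sum_congr rfl fun j _ => ?_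
  ring
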